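/- For every integer n ≥ 1, the kernel built with the forward difference operator Δ satisfies K_{n−1}^{(j,j)}(0,0) = (j! (1−μ)^{γ+2j} / (μ^j (γ)_j)) · ∑_{k=0}^{n−j−1} ((j+1)_k (γ+j)_k / (1)_k) · μ^k/k!, where the sum is empty (equal to 0) when n ≤ j. -/

import Mathlib

open Finset Filter Topology Polynomial

noncomputable section

/-- Pochhammer symbol `(a)_k = a(a+1)⋯(a+k−1)`. -/
def poch (a : ℝ) (k : ℕ) : ℝ := ∏ m ∈ Finset.range k, (a + m)

/-- Falling factorial `[x]_k = x(x−1)⋯(x−k+1)`. -/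
def fall (x : ℝ) (k : ℕ) : ℝ := ∏ m ∈ Finset.range k, (x - m)

/-- `⟨x⟩_i^k`: falling factorial for `i = 1`, Pochhammer symbol for `i = 2`. -/
def br (i : ℕ) (x : ℝ) (k : ℕ) : ℝ := if i = 1 then fall x k else poch x k

/-- Forward (`i = 1`) resp. backward (`i = 2`) difference operator `𝒟_i`. -/
def Dop (i : ℕ) (f : ℝ → ℝ) : ℝ → ℝ :=
  fun x => if i = 1 then f (x + 1) - f x else f x - f (x - 1)

/-- Iterated difference operator `𝒟_i^k`. -/
def Dk (i k : ℕ) (f : ℝ → ℝ) : ℝ → ℝ := (Dop i)^[k] f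

/-- Kronecker delta `δ_{i,m}` (real valued). -/
def kdelta (i m : ℕ) : ℝ := if i = m then 1 else 0

/-- The shift `x ± 1`: `x + 1` for `i = 1`, `x - 1` for `i = 2`. -/
def sh (i : ℕ) (x : ℝ) : ℝ := if i = 1 then x + 1 else x - 1

/-- Monic Meixner polynomial `M_n(x)`. -/
def MeixnerM (γ μ : ℝ) (n : ℕ) (x : ℝ) : ℝ :=
  poch γ n * (μ / (μ - 1)) ^ n *
    ∑ k ∈ Finset.range (n + 1),
      poch (-(n : ℝ)) k * poch (-x) k / poch γ k * (1 - μ⁻¹) ^ k / (Nat.factorial k : ℝ)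

/-- Meixner inner product `⟨p,q⟩ = ∑_{x≥0} p(x)q(x) μ^x (γ)_x / x!`. -/
def mIP (γ μ : ℝ) (p q : ℝ → ℝ) : ℝ :=
  ∑' x : ℕ, p x * q x * μ ^ x * poch γ x / (Nat.factorial x : ℝ)

/-- Squared Meixner norm `‖M_n‖²`. -/
def nrm2 (γ μ : ℝ) (n : ℕ) : ℝ := mIP γ μ (MeixnerM γ μ n) (MeixnerM γ μ n)

/-- Kernel `K_n^{(l,m)}(x,y)` for the operator `𝒟_i`. -/
def Klm (γ μ : ℝ) (i l m n : ℕ) (x y : ℝ) : ℝ :=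
  ∑ k ∈ Finset.range (n + 1),
    Dk i l (MeixnerM γ μ k) x * Dk i m (MeixnerM γ μ k) y / nrm2 γ μ k

/-- Sobolev inner product `⟨p,q⟩_λ = ⟨p,q⟩ + λ 𝒟_i^j p(α) 𝒟_i^j q(α)`. -/
def sIP (γ μ lam α : ℝ) (i j : ℕ) (p q : ℝ → ℝ) : ℝ :=
  mIP γ μ p q + lam * Dk i j p α * Dk i j q α

/-- `Q` is the monic Sobolev orthogonal polynomial of degree `n`. -/
def IsSobolevOP (γ μ lam α : ℝ) (i j n : ℕ) (Q : Polynomial ℝ) : Prop :=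
  Q.Monic ∧ Q.natDegree = n ∧
    ∀ p : Polynomial ℝ, p.degree < (n : WithBot ℕ) →
      sIP γ μ lam α i j (fun x => Q.eval x) (fun x => p.eval x) = 0

/-- Coefficient `a_n^{(k)}`. -/
def acoef (γ μ lam α : ℝ) (i j n k : ℕ) : ℝ :=
  -(lam * (Nat.factorial j : ℝ) * Dk i j (MeixnerM γ μ n) α * Dk i k (MeixnerM γ μ (n - 1)) α) /
    ((Nat.factorial k : ℝ) * nrm2 γ μ (n - 1) * (1 + lam * Klm γ μ i j j (n - 1) α α))

/-- Coefficient `b_n^{(k)}`. -/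
def bcoef (γ μ lam α : ℝ) (i j n k : ℕ) : ℝ :=
  lam * (Nat.factorial j : ℝ) * Dk i j (MeixnerM γ μ n) α * Dk i k (MeixnerM γ μ n) α /
    ((Nat.factorial k : ℝ) * nrm2 γ μ (n - 1) * (1 + lam * Klm γ μ i j j (n - 1) α α))

/-- Rational function `A_{1,n}(x)`. -/
def A1 (γ μ lam α : ℝ) (i j n : ℕ) (x : ℝ) : ℝ :=
  1 + (1 / br i (x - α) (j + 1)) *
    ∑ k ∈ Finset.range (j + 1), acoef γ μ lam α i j n k * br i (x - α) k

/-- Rational function `B_{1,n}(x)`. -/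
def B1 (γ μ lam α : ℝ) (i j n : ℕ) (x : ℝ) : ℝ :=
  (1 / br i (x - α) (j + 1)) *
    ∑ k ∈ Finset.range (j + 1), bcoef γ μ lam α i j n k * br i (x - α) k

/-- Meixner recurrence coefficient `α_n`. -/
def alphaR (γ μ : ℝ) (n : ℕ) : ℝ := ((n : ℝ) * (1 + μ) + μ * γ) / (1 - μ)

/-- Meixner recurrence coefficient `β_n`. -/
def betaR (γ μ : ℝ) (n : ℕ) : ℝ := (n : ℝ) * μ * ((n : ℝ) + γ - 1) / (1 - μ) ^ 2

/-- Rational function `A_{2,n}(x)`. -/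
def A2 (γ μ lam α : ℝ) (i j n : ℕ) (x : ℝ) : ℝ :=
  -(B1 γ μ lam α i j (n - 1) x) / betaR γ μ (n - 1)

/-- Rational function `B_{2,n}(x)`. -/
def B2 (γ μ lam α : ℝ) (i j n : ℕ) (x : ℝ) : ℝ :=
  A1 γ μ lam α i j (n - 1) x + A2 γ μ lam α i j n x * (alphaR γ μ (n - 1) - x)

/-- Rational function `C_{1,n}(x)`. -/
def C1 (γ μ lam α : ℝ) (i j n : ℕ) (x : ℝ) : ℝ :=
  (x + γ * kdelta i 1) * Dop i (A1 γ μ lam α i j n) x + (n : ℝ) * A1 γ μ lam α i j n (sh i x)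
    - ((n : ℝ) - 1) * ((n : ℝ) + γ - 2) * μ ^ kdelta i 2 * B1 γ μ lam α i j n (sh i x) /
        (betaR γ μ (n - 1) * (1 - μ))

/-- Rational function `D_{1,n}(x)`. -/
def D1 (γ μ lam α : ℝ) (i j n : ℕ) (x : ℝ) : ℝ :=
  (x + γ * kdelta i 1) * Dop i (B1 γ μ lam α i j n) x
    + ((n : ℝ) - 1) * B1 γ μ lam α i j n (sh i x)
    + ((n : ℝ) - 1) * ((n : ℝ) + γ - 2) * (x - alphaR γ μ (n - 1)) * μ ^ kdelta i 2 *
        B1 γ μ lam α i j n (sh i x) / (betaR γ μ (n - 1) * (1 - μ))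
    + (n : ℝ) * ((n : ℝ) + γ - 1) * μ ^ kdelta i 2 * A1 γ μ lam α i j n (sh i x) / (1 - μ)

/-- Rational function `C_{2,n}(x)`. -/
def C2 (γ μ lam α : ℝ) (i j n : ℕ) (x : ℝ) : ℝ :=
  -(D1 γ μ lam α i j (n - 1) x) / betaR γ μ (n - 1)

/-- Rational function `D_{2,n}(x)`. -/
def D2 (γ μ lam α : ℝ) (i j n : ℕ) (x : ℝ) : ℝ :=
  C1 γ μ lam α i j (n - 1) x + C2 γ μ lam α i j n x * (alphaR γ μ (n - 1) - x)

/-- `A_{m,n}(x)` for `m = 1, 2`. -/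
def Aa (γ μ lam α : ℝ) (i j n m : ℕ) (x : ℝ) : ℝ :=
  if m = 1 then A1 γ μ lam α i j n x else A2 γ μ lam α i j n x

/-- `B_{m,n}(x)` for `m = 1, 2`. -/
def Bb (γ μ lam α : ℝ) (i j n m : ℕ) (x : ℝ) : ℝ :=
  if m = 1 then B1 γ μ lam α i j n x else B2 γ μ lam α i j n x

/-- `C_{k,n}(x)` for `k = 1, 2`. -/
def Cc (γ μ lam α : ℝ) (i j n k : ℕ) (x : ℝ) : ℝ :=
  if k = 1 then C1 γ μ lam α i j n x else C2 γ μ lam α i j n x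

/-- `D_{k,n}(x)` for `k = 1, 2`. -/
def Dd (γ μ lam α : ℝ) (i j n k : ℕ) (x : ℝ) : ℝ :=
  if k = 1 then D1 γ μ lam α i j n x else D2 γ μ lam α i j n x

/-- `Λ_{m,n}^{(k)}(x) = (−1)^k (C_{k,n}(x) B_{m,n}(x) − A_{m,n}(x) D_{k,n}(x))`. -/
def Lam (γ μ lam α : ℝ) (i j n m k : ℕ) (x : ℝ) : ℝ :=
  (-1 : ℝ) ^ k * (Cc γ μ lam α i j n k x * Bb γ μ lam α i j n m x
    - Aa γ μ lam α i j n m x * Dd γ μ lam α i j n k x)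

/-- `Θ_n(x) = A_{1,n}(x) B_{2,n}(x) − B_{1,n}(x) A_{2,n}(x)`. -/
def Theta (γ μ lam α : ℝ) (i j n : ℕ) (x : ℝ) : ℝ :=
  A1 γ μ lam α i j n x * B2 γ μ lam α i j n x - B1 γ μ lam α i j n x * A2 γ μ lam α i j n x

/-- `Θ̃_n(x) = (x + γ δ_{i,1}) Θ_n(x)`. -/
def Thetatil (γ μ lam α : ℝ) (i j n : ℕ) (x : ℝ) : ℝ :=
  (x + γ * kdelta i 1) * Theta γ μ lam α i j n x

section Pochhammer

lemma poch_zero (a : ℝ) : poch a 0 = 1 := by simp [poch]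

lemma poch_succ (a : ℝ) (k : ℕ) : poch a (k + 1) = poch a k * (a + k) :=
  Finset.prod_range_succ _ _

lemma poch_add (a : ℝ) (i m : ℕ) : poch a (i + m) = poch a i * poch (a + i) m := by
  simp only [poch, Finset.prod_range_add, Nat.cast_add, add_assoc]

lemma poch_pos {a : ℝ} (ha : 0 < a) (k : ℕ) : 0 < poch a k :=
  Finset.prod_pos fun _ _ => by positivity

lemma poch_eq_eval (a : ℝ) (k : ℕ) : poch a k = (ascPochhammer ℝ k).eval a := by
  induction k with
  | zero => simp [poch_zero]
  | succ k ih => rw [poch_succ, ih, ascPochhammer_succ_eval]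

lemma poch_one (k : ℕ) : poch 1 k = (k.factorial : ℝ) := by
  rw [poch_eq_eval, ascPochhammer_eval_one]

lemma poch_natCast_succ (j k : ℕ) :
    (j.factorial : ℝ) * poch ((j : ℝ) + 1) k = ((j + k).factorial : ℝ) := by
  rw [← poch_one, ← poch_one, poch_add, add_comm (1 : ℝ)]

lemma fall_zero_right (x : ℝ) : fall x 0 = 1 := by simp [fall]

lemma fall_succ (x : ℝ) (k : ℕ) : fall x (k + 1) = fall x k * (x - k) :=
  Finset.prod_range_succ _ _

lemma fall_succ_left (x : ℝ) (k : ℕ) : fall (x + 1) (k + 1) = (x + 1) * fall x k := by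
  simp only [fall, Finset.prod_range_succ', mul_comm (x + 1), Nat.cast_zero, sub_zero,
    Nat.cast_add, Nat.cast_one, add_sub_add_right_eq_sub]

lemma poch_neg (x : ℝ) (k : ℕ) : poch (-x) k = (-1) ^ k * fall x k := by
  induction k with
  | zero => simp [poch_zero, fall_zero_right]
  | succ k ih => rw [poch_succ, fall_succ, ih]; ring

lemma fall_natCast (n k : ℕ) : fall n k = (n.descFactorial k : ℝ) := by
  rw [← descPochhammer_eval_eq_descFactorial, descPochhammer_eval_eq_prod_range, fall]

/-- Negative binomial series. -/
lemma hasSum_poch_mul_pow_div_factorial (a : ℝ) {μ : ℝ} (hμ0 : 0 < μ) (hμ1 : μ < 1) :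
    HasSum (fun x : ℕ => poch a x * μ ^ x / (x.factorial : ℝ)) ((1 - μ) ^ (-a)) := by
  have h := (Real.one_div_one_sub_rpow_hasFPowerSeriesOnBall_zero a).hasSum (y := μ)
    (by simp [enorm_eq_nnnorm, ← NNReal.coe_lt_one, abs_of_pos hμ0, hμ1])
  rw [zero_add, one_div, ← Real.rpow_neg (by linarith)] at h
  convert! h using 2 with x
  rw [FormalMultilinearSeries.ofScalars_apply_eq, ← Ring.multichoose_eq, poch_eq_eval,
    ← ascPochhammer_smeval_eq_eval, ← Ring.factorial_nsmul_multichoose_eq_ascPochhammer]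
  have hx : (x.factorial : ℝ) ≠ 0 := by positivity
  simp only [nsmul_eq_mul, smul_eq_mul]
  field_simp

end Pochhammer

section ForwardDifference

lemma Dk_one_eq_fwdDiff_iter (k : ℕ) (f : ℝ → ℝ) : Dk 1 k f = (fwdDiff 1)^[k] f := by
  have : Dop 1 = fwdDiff (1 : ℝ) := by
    funext f x
    simp [Dop, fwdDiff]
  rw [Dk, this]

lemma fwdDiff_fall (i : ℕ) :
    fwdDiff 1 (fun x => fall x (i + 1)) = ((i : ℝ) + 1) • fun x => fall x i := by
  funext x
  simp only [fwdDiff, fall_succ_left, Pi.smul_apply, smul_eq_mul]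
  rw [fall_succ]
  ring

lemma fwdDiff_iter_fall_zero (k i : ℕ) :
    (fwdDiff 1)^[k] (fun x => fall x i) 0 = if i = k then (k.factorial : ℝ) else 0 := by
  induction k generalizing i with
  | zero =>
    cases i with
    | zero => simp [fall_zero_right]
    | succ i => simp [fall, Finset.prod_range_succ']
  | succ k ih =>
    rw [Function.iterate_succ_apply]
    cases i with
    | zero => simp [fall_zero_right, fwdDiff_iter_eq_sum_shift]
    | succ i =>
      rw [fwdDiff_fall, fwdDiff_iter_const_smul, Pi.smul_apply, ih]
      by_cases h : i = k
      · simp [h, Nat.factorial_succ]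
      · simp [h]

/-- The `n`-th difference of `i ↦ (a + i)_m` for `m ≤ n`. -/
lemma sum_neg_one_pow_choose_poch (a : ℝ) {m n : ℕ} (h : m ≤ n) :
    ∑ i ∈ Finset.range (n + 1), (-1 : ℝ) ^ i * n.choose i * poch (a + i) m =
      if m = n then (-1) ^ n * (n.factorial : ℝ) else 0 := by
  set P : ℝ[X] := (ascPochhammer ℝ m).comp (X + C a) with hP
  have hdeg : P.natDegree = m := by simp [hP, natDegree_comp, ascPochhammer_natDegree]
  have hmon : P.Monic := (monic_ascPochhammer ℝ m).comp_X_add_C a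
  have key : (fwdDiff 1)^[n] P.eval 0 = if m = n then (n.factorial : ℝ) else 0 := by
    split_ifs with hmn
    · have := P.fwdDiff_iter_degree_eq_factorial
      rw [hdeg, hmn, hmon.leadingCoeff] at this
      simp [this]
    · rw [fwdDiff_iter_eq_zero_of_degree_lt (by omega)]
      rfl
  have : ∑ i ∈ Finset.range (n + 1), (-1 : ℝ) ^ i * n.choose i * poch (a + i) m =
      (-1) ^ n * (fwdDiff 1)^[n] P.eval 0 := by
    rw [fwdDiff_iter_eq_sum_shift, Finset.mul_sum]
    refine Finset.sum_congr rfl fun i hi => ?_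
    have hi : i ≤ n := by simpa [Nat.lt_succ_iff] using hi
    have hs : (-1 : ℝ) ^ n * (-1) ^ (n - i) = (-1) ^ i := by
      rw [← pow_add, show n + (n - i) = 2 * (n - i) + i by omega, pow_add, pow_mul]
      simp
    simp only [hP, eval_comp, eval_add, eval_X, eval_C, poch_eq_eval, zsmul_eq_mul, ← hs]
    push_cast
    simp [add_comm]
    ring
  rw [this, key]
  split_ifs <;> simp

end ForwardDifference

section Meixner

variable {γ μ : ℝ}

/-- Coefficient of the Meixner polynomial of degree `n` in the basis of falling factorials. -/
def meixnerCoeff (γ μ : ℝ) (n i : ℕ) : ℝ :=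
  poch γ n * (μ / (μ - 1)) ^ n * (n.choose i * (1 - μ⁻¹) ^ i / poch γ i)

lemma MeixnerM_eq_sum_fall (γ μ : ℝ) (n : ℕ) (x : ℝ) :
    MeixnerM γ μ n x = ∑ i ∈ Finset.range (n + 1), meixnerCoeff γ μ n i * fall x i := by
  rw [MeixnerM, Finset.mul_sum]
  refine Finset.sum_congr rfl fun i _ => ?_
  have hf : (i.factorial : ℝ) ≠ 0 := by positivity
  have hs : (-1 : ℝ) ^ i * (-1) ^ i = 1 := by rw [← mul_pow]; simp
  rw [poch_neg, poch_neg, fall_natCast, Nat.descFactorial_eq_factorial_mul_choose, meixnerCoeff]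
  field_simp
  push_cast
  linear_combination poch γ n * (μ / (μ - 1)) ^ n * n.choose i * fall x i * (1 - μ⁻¹) ^ i *
    (i.factorial : ℝ) / poch γ i * hs

lemma Dk_one_MeixnerM_zero (γ μ : ℝ) (j n : ℕ) :
    Dk 1 j (MeixnerM γ μ n) 0 = meixnerCoeff γ μ n j * (j.factorial : ℝ) := by
  have : MeixnerM γ μ n =
      ∑ i ∈ Finset.range (n + 1), meixnerCoeff γ μ n i • fun x => fall x i := by
    funext x
    simp [MeixnerM_eq_sum_fall]
  rw [Dk_one_eq_fwdDiff_iter, this, fwdDiff_iter_finsetSum, Finset.sum_apply]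
  simp only [fwdDiff_iter_const_smul, Pi.smul_apply, fwdDiff_iter_fall_zero, smul_eq_mul,
    mul_ite, mul_zero, Finset.sum_ite_eq', Finset.mem_range]
  split_ifs with h
  · rfl
  · simp [meixnerCoeff, Nat.choose_eq_zero_of_lt (show n < j by omega)]

/-- Mixed moments of the Meixner weight. -/
lemma hasSum_fall_mul_poch (hμ0 : 0 < μ) (hμ1 : μ < 1) (i m : ℕ) :
    HasSum (fun x : ℕ => fall x i * poch (x + γ) m * (μ ^ x * poch γ x / (x.factorial : ℝ)))
      (μ ^ i * poch γ (i + m) * (1 - μ) ^ (-(γ + (i + m : ℕ)))) := by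
  rw [← (add_left_injective i).hasSum_iff]
  · convert! (hasSum_poch_mul_pow_div_factorial (γ + (i + m : ℕ)) hμ0 hμ1).mul_left
      (μ ^ i * poch γ (i + m)) using 2 with y
    have h1 : poch γ (y + i) * poch (((y + i : ℕ) : ℝ) + γ) m =
        poch γ (i + m) * poch (γ + (i + m : ℕ)) y := by
      rw [add_comm _ γ, ← poch_add, ← poch_add]
      congr 1
      omega
    have h2 : (y.factorial : ℝ) * fall ((y + i : ℕ) : ℝ) i = ((y + i).factorial : ℝ) := by
      rw [fall_natCast]
      exact_mod_cast by simpa using Nat.factorial_mul_descFactorial (Nat.le_add_left i y)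
    have h3 : (y.factorial : ℝ) ≠ 0 := by positivity
    have h4 : ((y + i).factorial : ℝ) ≠ 0 := by positivity
    simp only [Function.comp]
    field_simp
    rw [pow_add]
    linear_combination
      (μ ^ y * μ ^ i * ((y.factorial : ℝ) * fall ((y + i : ℕ) : ℝ) i)) * h1 +
      (μ ^ y * μ ^ i * poch γ (i + m) * poch (γ + (i + m : ℕ)) y) * h2
  · intro x hx
    have : x < i := by
      by_contra! h
      exact hx ⟨x - i, Nat.sub_add_cancel h⟩
    simp [fall_natCast, Nat.descFactorial_of_lt this]

lemma hasSum_MeixnerM_mul_poch (hγ : 0 < γ) (hμ0 : 0 < μ) (hμ1 : μ < 1) {m n : ℕ} (h : m ≤ n) :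
    HasSum (fun x : ℕ =>
        MeixnerM γ μ n x * poch (x + γ) m * (μ ^ x * poch γ x / (x.factorial : ℝ)))
      (if m = n then
        poch γ n * (μ / (1 - μ)) ^ n * (n.factorial : ℝ) * (1 - μ) ^ (-(γ + n)) else 0) := by
  have hs := hasSum_sum fun i (_ : i ∈ Finset.range (n + 1)) =>
    (hasSum_fall_mul_poch (γ := γ) hμ0 hμ1 i m).mul_left (meixnerCoeff γ μ n i)
  have hval : ∑ i ∈ Finset.range (n + 1), meixnerCoeff γ μ n i *
      (μ ^ i * poch γ (i + m) * (1 - μ) ^ (-(γ + (i + m : ℕ)))) =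
      poch γ n * (μ / (μ - 1)) ^ n * (1 - μ) ^ (-(γ + m)) *
        ∑ i ∈ Finset.range (n + 1), (-1 : ℝ) ^ i * n.choose i * poch (γ + i) m := by
    rw [Finset.mul_sum]
    refine Finset.sum_congr rfl fun i _ => ?_
    have hp := (poch_pos hγ i).ne'
    have h1 : (1 - μ) ^ (-(γ + (i + m : ℕ))) = (1 - μ) ^ (-(γ + m)) / (1 - μ) ^ i := by
      rw [← Real.rpow_natCast, ← Real.rpow_sub (by linarith)]
      push_cast
      ring_nf
    have h2 : (1 - μ⁻¹) ^ i * μ ^ i / (1 - μ) ^ i = (-1) ^ i := by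
      rw [← mul_pow, ← div_pow]
      congr 1
      have : 1 - μ ≠ 0 := by linarith
      field_simp
      ring
    rw [h1, poch_add, meixnerCoeff, ← h2]
    field_simp
  rw [hval, sum_neg_one_pow_choose_poch γ h] at hs
  convert! hs using 1
  · funext x
    rw [MeixnerM_eq_sum_fall, Finset.sum_mul, Finset.sum_mul]
    exact Finset.sum_congr rfl fun i _ => by ring
  · split_ifs with hmn
    · rw [show μ / (1 - μ) = μ / (μ - 1) * -1 by rw [← neg_sub μ 1, div_neg]; ring, mul_pow, hmn]
      ring
    · simp

/-- Orthogonality of `M_n` to the mixed basis `[x]_i (x + γ)_m` of total degree at most `n`. -/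
lemma hasSum_MeixnerM_mul_fall_mul_poch (hγ : 0 < γ) (hμ0 : 0 < μ) (hμ1 : μ < 1) {i m n : ℕ}
    (h : i + m ≤ n) :
    HasSum (fun x : ℕ =>
        MeixnerM γ μ n x * fall x i * poch (x + γ) m * (μ ^ x * poch γ x / (x.factorial : ℝ)))
      (if i + m = n then
        poch γ n * (μ / (1 - μ)) ^ n * (n.factorial : ℝ) * (1 - μ) ^ (-(γ + n)) else 0) := by
  induction i generalizing m with
  | zero => simpa [fall_zero_right] using hasSum_MeixnerM_mul_poch hγ hμ0 hμ1 (by omega : m ≤ n)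
  | succ i ih =>
    have h1 := ih (m := m + 1) (by omega)
    have h2 := (ih (m := m) (by omega)).mul_left (γ + m + i)
    rw [if_neg (by omega : i + m ≠ n), mul_zero] at h2
    convert! h1.sub h2 using 1
    · funext x
      rw [poch_succ, fall_succ]
      ring
    · rw [sub_zero]
      congr 1
      simp [add_assoc, add_comm m 1]

lemma meixnerCoeff_self (hγ : 0 < γ) (hμ0 : 0 < μ) (hμ1 : μ < 1) (n : ℕ) :
    meixnerCoeff γ μ n n = 1 := by
  have h1 : (μ / (μ - 1)) ^ n * (1 - μ⁻¹) ^ n = 1 := by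
    have : μ - 1 ≠ 0 := by linarith
    rw [← mul_pow, show μ / (μ - 1) * (1 - μ⁻¹) = 1 by field_simp, one_pow]
  have hp := (poch_pos hγ n).ne'
  rw [meixnerCoeff, Nat.choose_self, Nat.cast_one, one_mul, ← mul_div_assoc, mul_assoc, h1, mul_one,
    div_self hp]

/-- The squared norm of the monic Meixner polynomials. -/
lemma nrm2_eq (hγ : 0 < γ) (hμ0 : 0 < μ) (hμ1 : μ < 1) (n : ℕ) :
    nrm2 γ μ n =
      poch γ n * (μ / (1 - μ)) ^ n * (n.factorial : ℝ) * (1 - μ) ^ (-(γ + n)) := by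
  have hs := hasSum_sum fun i (hi : i ∈ Finset.range (n + 1)) =>
    (hasSum_MeixnerM_mul_fall_mul_poch (m := 0) hγ hμ0 hμ1
      (Nat.lt_succ_iff.1 (Finset.mem_range.1 hi))).mul_left (meixnerCoeff γ μ n i)
  simp only [add_zero, mul_ite, mul_zero, Finset.sum_ite_eq', Finset.self_mem_range_succ, if_true,
    meixnerCoeff_self hγ hμ0 hμ1, one_mul] at hs
  rw [nrm2, mIP, ← hs.tsum_eq]
  refine tsum_congr fun x => ?_
  conv_lhs => enter [1, 1, 1, 2]; rw [MeixnerM_eq_sum_fall]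
  simp only [Finset.mul_sum, Finset.sum_mul, Finset.sum_div, poch_zero]
  exact Finset.sum_congr rfl fun i _ => by ring

lemma Klm_summand_eq (hγ : 0 < γ) (hμ0 : 0 < μ) (hμ1 : μ < 1) (j k : ℕ) :
    Dk 1 j (MeixnerM γ μ (j + k)) 0 * Dk 1 j (MeixnerM γ μ (j + k)) 0 / nrm2 γ μ (j + k) =
      (j.factorial : ℝ) * (1 - μ) ^ (γ + 2 * (j : ℝ)) / (μ ^ j * poch γ j) *
        (poch ((j : ℝ) + 1) k * poch (γ + (j : ℝ)) k / poch 1 k * μ ^ k / (k.factorial : ℝ)) := by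
  have hμ : 0 < 1 - μ := by linarith
  have hp := (poch_pos hγ j).ne'
  have hq := (poch_pos (by positivity : 0 < γ + (j : ℝ)) k).ne'
  have hj : (j.factorial : ℝ) ≠ 0 := by positivity
  have hk : (k.factorial : ℝ) ≠ 0 := by positivity
  have hjk : ((j + k).factorial : ℝ) ≠ 0 := by positivity
  have hchoose : ((j + k).choose j : ℝ) = (j + k).factorial / (j.factorial * k.factorial) := by
    rw [Nat.cast_add_choose]
  have hpj : poch ((j : ℝ) + 1) k = (j + k).factorial / j.factorial := by
    rw [← poch_natCast_succ]
    field_simp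
  have h1 : (1 - μ) ^ (-(γ + (j + k : ℕ))) = ((1 - μ) ^ γ)⁻¹ / (1 - μ) ^ (j + k) := by
    rw [neg_add, Real.rpow_add hμ, Real.rpow_neg hμ.le, Real.rpow_neg hμ.le, Real.rpow_natCast]
    rfl
  have h2 : (1 - μ) ^ (γ + 2 * (j : ℝ)) = (1 - μ) ^ γ * ((1 - μ) ^ j) ^ 2 := by
    rw [Real.rpow_add hμ, ← pow_mul, ← Real.rpow_natCast _ (j * 2)]
    push_cast
    ring_nf
  have h3 : 1 - μ⁻¹ = -((1 - μ) / μ) := by field_simp; ring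
  have h4 : μ / (μ - 1) = -(μ / (1 - μ)) := by rw [← neg_sub 1 μ, div_neg]
  have hr := (Real.rpow_pos_of_pos hμ γ).ne'
  rw [Dk_one_MeixnerM_zero, nrm2_eq hγ hμ0 hμ1, meixnerCoeff, hchoose, hpj, h1, h2, h3, h4,
    poch_one, poch_add, neg_pow _ j, neg_pow _ (j + k)]
  have hs : ∀ i : ℕ, ((-1 : ℝ) ^ i) ^ 2 = 1 := fun i => by rw [← pow_mul]; simp
  generalize (1 - μ) ^ γ = r at *
  generalize 1 - μ = ν at *
  have := hs j
  have := hs (j + k)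
  generalize (-1 : ℝ) ^ j = s at *
  generalize (-1 : ℝ) ^ (j + k) = t at *
  simp only [div_pow]
  field_simp
  simp only [*]
  ring

end Meixner

/-- value of the kernel `K_{n−1}^{(j,j)}(0,0)` for the forward difference operator. -/
theorem kernel_jj_at_zero (γ μ : ℝ) (hγ : 0 < γ) (hμ0 : 0 < μ) (hμ1 : μ < 1)
    (j : ℕ) (n : ℕ) (hn : 1 ≤ n) :
    Klm γ μ 1 j j (n - 1) 0 0 =
      (Nat.factorial j : ℝ) * (1 - μ) ^ (γ + 2 * (j : ℝ)) / (μ ^ j * poch γ j) *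
        ∑ k ∈ Finset.range (n - j),
          poch ((j : ℝ) + 1) k * poch (γ + (j : ℝ)) k / poch 1 k * μ ^ k /
            (Nat.factorial k : ℝ) := by
  rw [Klm, Nat.sub_add_cancel hn, Finset.mul_sum]
  rcases le_total n j with h | h
  · rw [Nat.sub_eq_zero_of_le h, Finset.sum_range_zero]
    refine Finset.sum_eq_zero fun k hk => ?_
    have hkj : k < j := (Finset.mem_range.1 hk).trans_le h
    simp [Dk_one_MeixnerM_zero, meixnerCoeff, Nat.choose_eq_zero_of_lt hkj]
  · obtain ⟨d, rfl⟩ := Nat.exists_eq_add_of_le h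
    rw [Finset.sum_range_add, Nat.add_sub_cancel_left, Finset.sum_eq_zero, zero_add]
    · exact Finset.sum_congr rfl fun k _ => Klm_summand_eq hγ hμ0 hμ1 j k
    · intro k hk
      simp [Dk_one_MeixnerM_zero, meixnerCoeff, Nat.choose_eq_zero_of_lt (Finset.mem_range.1 hk)]
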